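/- arXiv:quant-ph/0205025 — 3 statements merged into one kernel-verified Lean document; each statement's English description precedes it below -/
import Mathlib

section
/- Let n be an even positive integer, V a real n×n circulant symmetric positive definite matrix with blocks V = [[V', V''], [V'', V']], F = F_{n/2}, P = I_{n/2} ⊕ (−I_{n/2}), and let p ∈ [0, 1]. Let Q = V^{−p} P V^{p} P with block form Q = [[Q', Q''], [Q'', Q']]. The matrix Q' + Q''F equals (V' + V''F)^{−p}(V' − V''F)^{p}, a product of positive definite matrices, so all its eigenvalues are real and positive; likewise for Q' − Q''F. If V''F is positive semidefinite, then every eigenvalue of Q' + Q''F is at most 1; if V''F is negative semidefinite, then every eigenvalue of Q' − Q''F is at most 1. -/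
open Matrix

/-- The `m × m` flip matrix `F_m`: with 0-based indices, entry `(i,j)` is `1`
iff `i + j = m - 1`. -/
noncomputable def flipMat (m : ℕ) : Matrix (Fin m) (Fin m) ℝ :=
  Matrix.of fun i j => if (i : ℕ) + (j : ℕ) = m - 1 then 1 else 0

/-- Real matrix power `M ^ p` defined via the continuous functional calculus
(spectral calculus). -/
noncomputable def mpow {k : ℕ} (M : Matrix (Fin k) (Fin k) ℝ) (p : ℝ) :
    Matrix (Fin k) (Fin k) ℝ :=
  cfc (fun x : ℝ => x ^ p) M


open scoped MatrixOrder Matrix.Norms.L2Operator ComplexOrder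

section helpers

theorem exists_poly_eqOn (f : ℝ → ℝ) (s : Set ℝ) (hs : s.Finite) :
    ∃ q : Polynomial ℝ, s.EqOn f (fun x => q.eval x) := by
  classical
  refine ⟨Lagrange.interpolate hs.toFinset id f, fun x hx => ?_⟩
  have := Lagrange.eval_interpolate_at_node (s := hs.toFinset) (v := id) (r := f) (i := x)
    (fun _ _ _ _ h => h) (by simpa using hx)
  simpa using this.symm

theorem spec_finite {𝕜 : Type*} [RCLike 𝕜] {k : ℕ} (A : Matrix (Fin k) (Fin k) 𝕜) :
    (spectrum ℝ A).Finite := by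
  exact Matrix.finite_real_spectrum

theorem cfc_eq_aeval {𝕜 : Type*} [RCLike 𝕜] {k : ℕ} {A : Matrix (Fin k) (Fin k) 𝕜}
    (hA : A.IsHermitian) (f : ℝ → ℝ) (q : Polynomial ℝ)
    (h : (spectrum ℝ A).EqOn f (fun x => q.eval x)) :
    cfc f A = Polynomial.aeval A q := by
  rw [cfc_congr h]
  exact cfc_polynomial q A hA.isSelfAdjoint

theorem aeval_intertwine {k l : ℕ} {V : Matrix (Fin k) (Fin k) ℝ} {A : Matrix (Fin l) (Fin l) ℝ}
    {U : Matrix (Fin k) (Fin l) ℝ} (h : V * U = U * A) (q : Polynomial ℝ) :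
    Polynomial.aeval V q * U = U * Polynomial.aeval A q := by
  induction q using Polynomial.induction_on' with
  | add p q hp hq => simp [Matrix.add_mul, Matrix.mul_add, hp, hq]
  | monomial n a =>
    have : ∀ n : ℕ, V ^ n * U = U * A ^ n := by
      intro n
      induction n with
      | zero => simp
      | succ n ih =>
        rw [pow_succ, Matrix.mul_assoc, h, ← Matrix.mul_assoc, ih, Matrix.mul_assoc, ← pow_succ]
    simp [Polynomial.aeval_monomial, Algebra.algebraMap_eq_smul_one, this]

theorem mpow_intertwine {k l : ℕ} {V : Matrix (Fin k) (Fin k) ℝ} {A : Matrix (Fin l) (Fin l) ℝ}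
    {U : Matrix (Fin k) (Fin l) ℝ} (h : V * U = U * A) (hV : V.IsHermitian) (hA : A.IsHermitian)
    (p : ℝ) : mpow V p * U = U * mpow A p := by
  obtain ⟨q, hq⟩ := exists_poly_eqOn (fun x : ℝ => x ^ p) (spectrum ℝ V ∪ spectrum ℝ A)
    ((spec_finite V).union (spec_finite A))
  unfold mpow
  rw [cfc_eq_aeval hV _ q (hq.mono Set.subset_union_left),
    cfc_eq_aeval hA _ q (hq.mono Set.subset_union_right)]
  exact aeval_intertwine h q

/-- complexification -/
noncomputable def cpx (l : ℕ) : Matrix (Fin l) (Fin l) ℝ →ₐ[ℝ] Matrix (Fin l) (Fin l) ℂ :=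
  Complex.ofRealAm.mapMatrix

theorem cpx_apply {l : ℕ} (A : Matrix (Fin l) (Fin l) ℝ) : cpx l A = A.map Complex.ofReal := rfl

theorem cpx_conjTranspose {l : ℕ} (A : Matrix (Fin l) (Fin l) ℝ) : cpx l Aᴴ = (cpx l A)ᴴ := by
  ext i j
  simp [cpx_apply]

theorem cpx_herm {l : ℕ} {A : Matrix (Fin l) (Fin l) ℝ} (hA : A.IsHermitian) :
    (cpx l A).IsHermitian := by
  unfold Matrix.IsHermitian
  rw [← cpx_conjTranspose, hA.eq]

theorem cpx_psd {l : ℕ} {A : Matrix (Fin l) (Fin l) ℝ} (hA : A.PosSemidef) :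
    (cpx l A).PosSemidef := by
  obtain ⟨B, rfl⟩ := CStarAlgebra.nonneg_iff_eq_star_mul_self.mp hA.nonneg
  rw [Matrix.star_eq_conjTranspose, map_mul, cpx_conjTranspose]
  exact Matrix.posSemidef_conjTranspose_mul_self _

theorem cpx_pd {l : ℕ} {A : Matrix (Fin l) (Fin l) ℝ} (hA : A.PosDef) :
    (cpx l A).PosDef :=
  (cpx_psd hA.posSemidef).posDef_iff_isUnit.mpr (hA.isUnit.map (cpx l))

theorem cpx_mpow {l : ℕ} {A : Matrix (Fin l) (Fin l) ℝ} (hA : A.IsHermitian) (p : ℝ) :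
    cpx l (mpow A p) = cfc (fun x : ℝ => x ^ p) (cpx l A) := by
  obtain ⟨q, hq⟩ := exists_poly_eqOn (fun x : ℝ => x ^ p) (spectrum ℝ A ∪ spectrum ℝ (cpx l A))
    ((spec_finite A).union (spec_finite _))
  unfold mpow
  rw [cfc_eq_aeval hA _ q (hq.mono Set.subset_union_left),
    cfc_eq_aeval (cpx_herm hA) _ q (hq.mono Set.subset_union_right), Polynomial.aeval_algHom_apply]

theorem spec_pos {l : ℕ} {A : Matrix (Fin l) (Fin l) ℝ} (hA : A.PosDef) {x : ℝ}
    (hx : x ∈ spectrum ℝ A) : 0 < x := by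
  rw [hA.isHermitian.spectrum_real_eq_range_eigenvalues] at hx
  obtain ⟨i, rfl⟩ := hx
  exact hA.eigenvalues_pos i

theorem mpow_mul_neg {l : ℕ} {A : Matrix (Fin l) (Fin l) ℝ} (hA : A.PosDef) (p : ℝ) :
    mpow A p * mpow A (-p) = 1 := by
  have hsa : IsSelfAdjoint A := hA.isHermitian.isSelfAdjoint
  unfold mpow
  rw [← cfc_mul _ _ A ((spec_finite A).continuousOn _) ((spec_finite A).continuousOn _),
    ← cfc_one ℝ A hsa]
  refine cfc_congr fun x hx => ?_
  have := spec_pos hA hx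
  simp [← Real.rpow_add this]

theorem mpow_pd {l : ℕ} {A : Matrix (Fin l) (Fin l) ℝ} (hA : A.PosDef) (p : ℝ) :
    (mpow A p).PosDef := by
  have h : (mpow A p).PosSemidef := by
    rw [← Matrix.nonneg_iff_posSemidef]
    exact cfc_nonneg fun x hx => Real.rpow_nonneg (spec_pos hA hx).le _
  refine h.posDef_iff_isUnit.mpr ?_
  exact IsUnit.of_mul_eq_one _ (mpow_mul_neg hA p)

theorem mpow_mono {l : ℕ} {A B : Matrix (Fin l) (Fin l) ℝ} (hA : A.PosDef) (hB : B.PosDef)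
    (h : (A - B).PosSemidef) {p : ℝ} (hp : p ∈ Set.Icc (0 : ℝ) 1) :
    (cpx l (mpow A p) - cpx l (mpow B p)).PosSemidef := by
  rw [← Matrix.le_iff, cpx_mpow hA.isHermitian, cpx_mpow hB.isHermitian,
    ← CFC.rpow_eq_cfc_real (cpx_psd hA.posSemidef).nonneg,
    ← CFC.rpow_eq_cfc_real (cpx_psd hB.posSemidef).nonneg]
  refine CFC.rpow_le_rpow hp ?_
  rw [Matrix.le_iff, ← map_sub]
  exact cpx_psd h

theorem eig_prod {l : ℕ} {A B : Matrix (Fin l) (Fin l) ℝ} (hA : A.PosDef) (hB : B.PosDef) (p : ℝ)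
    {z : ℂ} (hz : z ∈ spectrum ℂ ((mpow A (-p) * mpow B p).map Complex.ofReal)) :
    ∃ r : ℝ, 0 < r ∧ z = (r : ℂ) ∧
      ((cpx l (mpow A p) - cpx l (mpow B p)).PosSemidef → r ≤ 1) := by
  rw [← cpx_apply, ← Matrix.spectrum_toLin', ← Module.End.hasEigenvalue_iff_mem_spectrum] at hz
  obtain ⟨w, hw⟩ := hz.exists_hasEigenvector
  have hw0 : w ≠ 0 := hw.2
  have hw1 := hw.apply_eq_smul
  rw [Matrix.toLin'_apply, map_mul] at hw1
  set C := cpx l (mpow A p) with hC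
  set D := cpx l (mpow B p) with hD
  have hCpd : C.PosDef := cpx_pd (mpow_pd hA p)
  have hDpd : D.PosDef := cpx_pd (mpow_pd hB p)
  have h1 : D *ᵥ w = z • (C *ᵥ w) := by
    have h2 : C * cpx l (mpow A (-p)) = 1 := by
      rw [hC, ← map_mul, mpow_mul_neg hA, map_one]
    rw [← Matrix.mulVec_smul, ← hw1, Matrix.mulVec_mulVec, ← Matrix.mul_assoc, h2, Matrix.one_mul]
  have h3 : star w ⬝ᵥ (D *ᵥ w) = z * (star w ⬝ᵥ (C *ᵥ w)) := by
    rw [h1, dotProduct_smul, smul_eq_mul]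
  have hc := hCpd.dotProduct_mulVec_pos hw0
  have hd := hDpd.dotProduct_mulVec_pos hw0
  have hle : (C - D).PosSemidef → star w ⬝ᵥ (D *ᵥ w) ≤ star w ⬝ᵥ (C *ᵥ w) := by
    intro h
    have := h.dotProduct_mulVec_nonneg w
    rwa [Matrix.sub_mulVec, dotProduct_sub, sub_nonneg] at this
  generalize star w ⬝ᵥ (C *ᵥ w) = c at *
  generalize star w ⬝ᵥ (D *ᵥ w) = d at *
  obtain ⟨c, rfl⟩ : ∃ c' : ℝ, c = (c' : ℂ) :=
    ⟨c.re, Complex.ext (by simp) (by simpa using (Complex.lt_def.mp hc).2.symm)⟩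
  obtain ⟨d, rfl⟩ : ∃ c' : ℝ, d = (c' : ℂ) :=
    ⟨d.re, Complex.ext (by simp) (by simpa using (Complex.lt_def.mp hd).2.symm)⟩
  have hc' : 0 < c := by exact_mod_cast hc
  have hd' : 0 < d := by exact_mod_cast hd
  refine ⟨d / c, div_pos hd' hc', ?_, fun h => ?_⟩
  · have : (c : ℂ) ≠ 0 := by exact_mod_cast hc'.ne'
    push_cast
    rw [h3]
    field_simp
  · rw [div_le_one hc']
    exact_mod_cast hle h

theorem flip_apply (m : ℕ) (i j : Fin m) : flipMat m i j = if j = Fin.rev i then 1 else 0 := by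
  unfold flipMat
  simp only [Matrix.of_apply, Fin.ext_iff, Fin.val_rev]
  congr 1
  apply propext
  omega

theorem mul_flip {l m : ℕ} (M : Matrix (Fin l) (Fin m) ℝ) (i : Fin l) (j : Fin m) :
    (M * flipMat m) i j = M i (Fin.rev j) := by
  rw [Matrix.mul_apply, Finset.sum_eq_single (Fin.rev j)]
  · simp [flip_apply]
  · intro b _ hb
    rw [flip_apply, if_neg, mul_zero]
    rintro rfl
    simp at hb
  · simp

theorem flip_mul {l m : ℕ} (M : Matrix (Fin m) (Fin l) ℝ) (i : Fin m) (j : Fin l) :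
    (flipMat m * M) i j = M (Fin.rev i) j := by
  rw [Matrix.mul_apply, Finset.sum_eq_single (Fin.rev i)]
  · simp [flip_apply]
  · intro b _ hb
    rw [flip_apply, if_neg hb, zero_mul]
  · simp

/-- The intertwiner. -/
noncomputable def Umat (m : ℕ) (s : ℝ) : Matrix (Fin (m + m)) (Fin m) ℝ :=
  Matrix.of fun a j => Fin.addCases (fun i => (1 : Matrix (Fin m) (Fin m) ℝ) i j)
    (fun i => (s • flipMat m) i j) a

theorem mul_Umat_apply {l m : ℕ} (M : Matrix (Fin l) (Fin (m + m)) ℝ) (s : ℝ) (i : Fin l)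
    (j : Fin m) : (M * Umat m s) i j
      = M i (Fin.castAdd m j) + s * M i (Fin.natAdd m (Fin.rev j)) := by
  have h1 := congrFun (congrFun (Matrix.mul_one (Matrix.of fun i j => M i (Fin.castAdd m j))) i) j
  have h2 := mul_flip (Matrix.of fun i j => M i (Fin.natAdd m j)) i j
  rw [Matrix.mul_apply] at h1 h2
  simp only [Matrix.of_apply] at h1 h2
  rw [Matrix.mul_apply, Fin.sum_univ_add, ← h1, ← h2, Finset.mul_sum]
  simp only [Umat, Matrix.of_apply, Fin.addCases_left, Fin.addCases_right, Matrix.smul_apply,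
    smul_eq_mul]
  congr 1
  refine Finset.sum_congr rfl fun x _ => by ring

theorem Umat_mul_left {m : ℕ} (s : ℝ) (A : Matrix (Fin m) (Fin m) ℝ) (i j : Fin m) :
    (Umat m s * A) (Fin.castAdd m i) j = A i j := by
  have := congrFun (congrFun (Matrix.one_mul A) i) j
  rw [← this, Matrix.mul_apply, Matrix.mul_apply]
  simp [Umat]

theorem Umat_mul_right {m : ℕ} (s : ℝ) (A : Matrix (Fin m) (Fin m) ℝ) (i j : Fin m) :
    (Umat m s * A) (Fin.natAdd m i) j = s * A (Fin.rev i) j := by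
  rw [← flip_mul A i j, Matrix.mul_apply, Matrix.mul_apply, Finset.mul_sum]
  simp only [Umat, Matrix.of_apply, Fin.addCases_right, Matrix.smul_apply, smul_eq_mul, mul_assoc]

theorem Umat_inj {m : ℕ} (s : ℝ) : Function.Injective (Umat m s).mulVec := by
  intro x y h
  ext i
  have h1 := congrFun h (Fin.castAdd m i)
  simpa [Matrix.mulVec, dotProduct, Umat, Matrix.one_apply] using h1

theorem circ_eq {m : ℕ} {v : Fin (m + m) → ℝ} (a b c d : Fin (m + m))
    (h : ∃ k : ℤ, (k = 0 ∨ k = 1 ∨ k = -1) ∧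
      ((a : ℕ) : ℤ) - (b : ℕ) - ((c : ℕ) - (d : ℕ)) = k * (m + m)) :
    Matrix.circulant v a b = Matrix.circulant v c d := by
  simp only [Matrix.circulant_apply]
  congr 1
  obtain ⟨k, hk, h⟩ := h
  have h1 := Fin.intCast_val_sub_eq_sub_add_ite a b
  have h2 := Fin.intCast_val_sub_eq_sub_add_ite c d
  have := (a - b).isLt
  have := (c - d).isLt
  have := a.isLt
  have := b.isLt
  have := c.isLt
  have := d.isLt
  apply Fin.ext
  rcases hk with rfl | rfl | rfl <;> split_ifs at h1 h2 <;> push_cast at * <;> omega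

theorem circ_symm {m : ℕ} (hm : 0 < m) {v : Fin (m + m) → ℝ} (hv : ∀ l, v (-l) = v l)
    (a b : Fin (m + m)) : Matrix.circulant v a b = Matrix.circulant v b a := by
  have : NeZero (m + m) := ⟨by omega⟩
  simp only [Matrix.circulant_apply]
  rw [← hv, neg_sub]

theorem block_main (m : ℕ) (hm : 0 < m)
    (v : Fin (m + m) → ℝ) (hv : ∀ l, v (-l) = v l)
    (V : Matrix (Fin (m + m)) (Fin (m + m)) ℝ) (hV : V = Matrix.circulant v)
    (V₁ V₂ : Matrix (Fin m) (Fin m) ℝ)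
    (hV₁ : ∀ i j, V₁ i j = V (Fin.castAdd m i) (Fin.castAdd m j))
    (hV₂ : ∀ i j, V₂ i j = V (Fin.castAdd m i) (Fin.natAdd m j))
    (s : ℝ) (hs : s * s = 1) :
    V * Umat m s = Umat m s * (V₁ + s • (V₂ * flipMat m)) := by
  ext a j
  rw [mul_Umat_apply]
  refine Fin.addCases (fun i => ?_) (fun i => ?_) a
  · rw [Umat_mul_left, Matrix.add_apply, Matrix.smul_apply, mul_flip, hV₁, hV₂, smul_eq_mul]
  · rw [Umat_mul_right, Matrix.add_apply, Matrix.smul_apply, mul_flip, hV₁, hV₂, smul_eq_mul,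
      mul_add, ← mul_assoc, hs, one_mul, add_comm]
    have e1 : V (Fin.natAdd m i) (Fin.natAdd m (Fin.rev j))
        = V (Fin.castAdd m (Fin.rev i)) (Fin.castAdd m j) := by
      rw [hV, circ_symm hm hv]
      refine circ_eq _ _ _ _ ⟨0, by simp, ?_⟩
      have := i.isLt
      have := j.isLt
      simp only [Fin.val_natAdd, Fin.val_castAdd, Fin.val_rev]
      omega
    have e2 : V (Fin.natAdd m i) (Fin.castAdd m j)
        = V (Fin.castAdd m (Fin.rev i)) (Fin.natAdd m (Fin.rev j)) := by
      rw [hV, circ_symm hm hv]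
      refine circ_eq _ _ _ _ ⟨0, by simp, ?_⟩
      have := i.isLt
      have := j.isLt
      simp only [Fin.val_natAdd, Fin.val_castAdd, Fin.val_rev]
      omega
    rw [e1, e2]

theorem UtU (m : ℕ) (s : ℝ) (hs : s * s = 1) : (Umat m s)ᴴ * Umat m s = (2 : ℝ) • 1 := by
  ext i j
  rw [mul_Umat_apply]
  simp only [Matrix.conjTranspose_apply, Umat, Matrix.of_apply, Fin.addCases_left,
    Fin.addCases_right, Matrix.smul_apply, flip_apply, Matrix.one_apply, star_trivial, smul_eq_mul,
    Fin.rev_rev]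
  rw [← mul_assoc, hs]
  by_cases h : i = j
  · subst h; norm_num
  · simp [h, Ne.symm h]

theorem block_pd {m : ℕ} {V : Matrix (Fin (m + m)) (Fin (m + m)) ℝ} (hV : V.PosDef)
    {A : Matrix (Fin m) (Fin m) ℝ} {s : ℝ} (hs : s * s = 1) (h : V * Umat m s = Umat m s * A) :
    A.PosDef := by
  have h1 := hV.conjTranspose_mul_mul_same (Umat_inj (m := m) s)
  rw [Matrix.mul_assoc, h, ← Matrix.mul_assoc, UtU m s hs, Matrix.smul_mul, Matrix.one_mul] at h1
  have h2 := h1.smul (show (0 : ℝ) < 1 / 2 by norm_num)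
  rw [smul_smul] at h2
  norm_num at h2
  exact h2

theorem P_U (m : ℕ) (s : ℝ) :
    Matrix.diagonal (fun i : Fin (m + m) => if (i : ℕ) < m then (1 : ℝ) else -1) * Umat m s
      = Umat m (-s) := by
  ext a j
  rw [Matrix.diagonal_mul]
  refine Fin.addCases (fun i => ?_) (fun i => ?_) a
  · simp [Umat]
  · simp only [Umat, Matrix.of_apply, Fin.addCases_right, Matrix.smul_apply, smul_eq_mul]
    rw [if_neg (by simp)]
    ring

theorem Q_block {m : ℕ} {V P Q : Matrix (Fin (m + m)) (Fin (m + m)) ℝ}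
    {A B Q₁ Q₂ : Matrix (Fin m) (Fin m) ℝ} {s p : ℝ}
    (hP : P = Matrix.diagonal (fun i : Fin (m + m) => if (i : ℕ) < m then (1 : ℝ) else -1))
    (hQ : Q = mpow V (-p) * P * mpow V p * P)
    (hQ₁ : ∀ i j, Q₁ i j = Q (Fin.castAdd m i) (Fin.castAdd m j))
    (hQ₂ : ∀ i j, Q₂ i j = Q (Fin.castAdd m i) (Fin.natAdd m j))
    (hV : V.IsHermitian) (hA : A.IsHermitian) (hB : B.IsHermitian)
    (h1 : V * Umat m s = Umat m s * A) (h2 : V * Umat m (-s) = Umat m (-s) * B) :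
    Q₁ + s • (Q₂ * flipMat m) = mpow A (-p) * mpow B p := by
  have h : Q * Umat m s = Umat m s * (mpow A (-p) * mpow B p) := by
    rw [hQ, Matrix.mul_assoc, hP, P_U, Matrix.mul_assoc, mpow_intertwine h2 hV hB,
      Matrix.mul_assoc, ← Matrix.mul_assoc _ (Umat m (-s)), P_U, neg_neg, ← Matrix.mul_assoc,
      mpow_intertwine h1 hV hA, Matrix.mul_assoc]
  ext i j
  have h3 := congrFun (congrFun h (Fin.castAdd m i)) j
  rw [mul_Umat_apply, Umat_mul_left] at h3
  rw [← h3, Matrix.add_apply, Matrix.smul_apply, mul_flip, hQ₁, hQ₂, smul_eq_mul]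

end helpers

/-- For `V` circulant symmetric positive definite with blocks
`[[V', V''], [V'', V']]`, `p ∈ [0,1]`, and `Q = V^{-p} P V^{p} P` with blocks
`[[Q', Q''], [Q'', Q']]`: `Q' + Q''F = (V'+V''F)^{-p}(V'-V''F)^{p}` and
`Q' - Q''F = (V'-V''F)^{-p}(V'+V''F)^{p}` are products of positive definite
matrices, so all their eigenvalues (over `ℂ`) are real and positive.
If `V''F ≥ 0` then every eigenvalue of `Q' + Q''F` is at most `1`;
if `V''F ≤ 0` then every eigenvalue of `Q' - Q''F` is at most `1`. -/
theorem eigenvalues_of_Q_blocks_bounded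
    (m : ℕ) (hm : 0 < m)
    (v : Fin (m + m) → ℝ) (hv : ∀ l, v (-l) = v l)
    (V : Matrix (Fin (m + m)) (Fin (m + m)) ℝ) (hV : V = Matrix.circulant v)
    (hVpd : V.PosDef)
    (V₁ V₂ : Matrix (Fin m) (Fin m) ℝ)
    (hV₁ : ∀ i j, V₁ i j = V (Fin.castAdd m i) (Fin.castAdd m j))
    (hV₂ : ∀ i j, V₂ i j = V (Fin.castAdd m i) (Fin.natAdd m j))
    (p : ℝ) (hp : p ∈ Set.Icc (0 : ℝ) 1)
    (P : Matrix (Fin (m + m)) (Fin (m + m)) ℝ)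
    (hP : P = Matrix.diagonal (fun i : Fin (m + m) => if (i : ℕ) < m then (1 : ℝ) else -1))
    (Q : Matrix (Fin (m + m)) (Fin (m + m)) ℝ)
    (hQ : Q = mpow V (-p) * P * mpow V p * P)
    (Q₁ Q₂ : Matrix (Fin m) (Fin m) ℝ)
    (hQ₁ : ∀ i j, Q₁ i j = Q (Fin.castAdd m i) (Fin.castAdd m j))
    (hQ₂ : ∀ i j, Q₂ i j = Q (Fin.castAdd m i) (Fin.natAdd m j)) :
    (V₁ + V₂ * flipMat m).PosDef
    ∧ (V₁ - V₂ * flipMat m).PosDef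
    ∧ Q₁ + Q₂ * flipMat m
        = mpow (V₁ + V₂ * flipMat m) (-p) * mpow (V₁ - V₂ * flipMat m) p
    ∧ Q₁ - Q₂ * flipMat m
        = mpow (V₁ - V₂ * flipMat m) (-p) * mpow (V₁ + V₂ * flipMat m) p
    ∧ (∀ z ∈ spectrum ℂ ((Q₁ + Q₂ * flipMat m).map Complex.ofReal),
        ∃ r : ℝ, 0 < r ∧ z = (r : ℂ))
    ∧ (∀ z ∈ spectrum ℂ ((Q₁ - Q₂ * flipMat m).map Complex.ofReal),
        ∃ r : ℝ, 0 < r ∧ z = (r : ℂ))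
    ∧ ((V₂ * flipMat m).PosSemidef →
        ∀ z ∈ spectrum ℂ ((Q₁ + Q₂ * flipMat m).map Complex.ofReal),
          ∃ r : ℝ, 0 < r ∧ r ≤ 1 ∧ z = (r : ℂ))
    ∧ ((-(V₂ * flipMat m)).PosSemidef →
        ∀ z ∈ spectrum ℂ ((Q₁ - Q₂ * flipMat m).map Complex.ofReal),
          ∃ r : ℝ, 0 < r ∧ r ≤ 1 ∧ z = (r : ℂ)) := by
  have a1 := block_main m hm v hv V hV V₁ V₂ hV₁ hV₂ 1 (by norm_num)
  have a2 := block_main m hm v hv V hV V₁ V₂ hV₁ hV₂ (-1) (by norm_num)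
  rw [one_smul] at a1
  rw [neg_one_smul, ← sub_eq_add_neg] at a2
  have hA := block_pd hVpd (by norm_num) a1
  have hB := block_pd hVpd (by norm_num) a2
  have q1 := Q_block hP hQ hQ₁ hQ₂ hVpd.isHermitian hA.isHermitian hB.isHermitian a1 a2
  have q2 := Q_block hP hQ hQ₁ hQ₂ hVpd.isHermitian hB.isHermitian hA.isHermitian a2
    (by rw [neg_neg]; exact a1)
  rw [one_smul] at q1
  rw [neg_one_smul, ← sub_eq_add_neg] at q2
  refine ⟨hA, hB, q1, q2, ?_, ?_, ?_, ?_⟩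
  · intro z hz
    rw [q1] at hz
    obtain ⟨r, h1, h2, -⟩ := eig_prod hA hB p hz
    exact ⟨r, h1, h2⟩
  · intro z hz
    rw [q2] at hz
    obtain ⟨r, h1, h2, -⟩ := eig_prod hB hA p hz
    exact ⟨r, h1, h2⟩
  · intro h z hz
    rw [q1] at hz
    obtain ⟨r, h1, h2, h3⟩ := eig_prod hA hB p hz
    refine ⟨r, h1, h3 (mpow_mono hA hB ?_ hp), h2⟩
    have := h.add h
    convert this using 1
    abel
  · intro h z hz
    rw [q2] at hz
    obtain ⟨r, h1, h2, h3⟩ := eig_prod hB hA p hz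
    refine ⟨r, h1, h3 (mpow_mono hB hA ?_ hp), h2⟩
    have := h.add h
    convert this using 1
    abel
end

section
/- (Theorem 1, equality case) Let n be an even positive integer and V a real n×n circulant symmetric positive definite matrix with block form V = [[V', V''], [V'', V']], F = F_{n/2}. If V''F is positive semidefinite or negative semidefinite, then the logarithmic negativity of the symmetrically bisected chain satisfies N(V) = |Tr(F_n · log₂ V)| / 2. -/
open Matrix Polynomial

/-- Matrix base-2 logarithm `log₂ M = (log M)/ln 2` defined via the continuous
functional calculus (spectral calculus). -/
noncomputable def mlogb2 {k : ℕ} (M : Matrix (Fin k) (Fin k) ℝ) :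
    Matrix (Fin k) (Fin k) ℝ :=
  cfc (fun x : ℝ => Real.logb 2 x) M


lemma aux_poly {k l : ℕ} (f : ℝ → ℝ) (A B : Matrix (Fin k) (Fin k) ℝ)
    (V : Matrix (Fin l) (Fin l) ℝ) (hA : A.IsHermitian) (hB : B.IsHermitian)
    (hV : V.IsHermitian) : ∃ q : ℝ[X], cfc f A = aeval A q ∧ cfc f B = aeval B q ∧
      cfc f V = aeval V q := by
  have fin : ∀ {r : ℕ} (M : Matrix (Fin r) (Fin r) ℝ), M.IsHermitian →
      (spectrum ℝ M).Finite := fun M hM => by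
    rw [hM.spectrum_real_eq_range_eigenvalues]; exact Set.finite_range _
  let S := (fin A hA).toFinset ∪ ((fin B hB).toFinset ∪ (fin V hV).toFinset)
  let q : ℝ[X] := Lagrange.interpolate S id f
  have hq : ∀ x ∈ S, f x = q.eval x := fun x hx =>
    (Lagrange.eval_interpolate_at_node f (v := id) (Set.injOn_id _) hx).symm
  refine ⟨q, ?_, ?_, ?_⟩
  · rw [← cfc_polynomial (p := IsSelfAdjoint) q A hA]
    exact cfc_congr fun x hx => hq x (by simp [S, hx])
  · rw [← cfc_polynomial (p := IsSelfAdjoint) q B hB]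
    exact cfc_congr fun x hx => hq x (by simp [S, hx])
  · rw [← cfc_polynomial (p := IsSelfAdjoint) q V hV]
    exact cfc_congr fun x hx => hq x (by simp [S, hx])

lemma aux_intertwine {α β : Type*} [Fintype α] [Fintype β] [DecidableEq α] [DecidableEq β]
    (V : Matrix α α ℝ) (D : Matrix β β ℝ) (W : Matrix α β ℝ) (h : V * W = W * D) (q : ℝ[X]) :
    aeval V q * W = W * aeval D q := by
  have hp : ∀ n : ℕ, V ^ n * W = W * D ^ n := by
    intro n
    induction n with
    | zero => simp
    | succ n ih => rw [pow_succ, Matrix.mul_assoc, h, ← Matrix.mul_assoc, ih, pow_succ,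
        Matrix.mul_assoc]
  induction q using Polynomial.induction_on' with
  | add p q hp hq => simp [Matrix.add_mul, Matrix.mul_add, hp, hq]
  | monomial n a =>
    simp only [aeval_monomial, Algebra.algebraMap_eq_smul_one, smul_mul_assoc, one_mul]
    rw [Matrix.smul_mul, hp, Matrix.mul_smul]

lemma aux_blocks {α β : Type*} [Fintype α] [Fintype β] [DecidableEq α] [DecidableEq β]
    (A : Matrix α α ℝ) (B : Matrix β β ℝ) (q : ℝ[X]) :
    aeval (fromBlocks A 0 0 B) q = fromBlocks (aeval A q) 0 0 (aeval B q) := by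
  have hp : ∀ n : ℕ, (fromBlocks A 0 0 B) ^ n = fromBlocks (A ^ n) 0 0 (B ^ n) := by
    intro n
    induction n with
    | zero => simp
    | succ n ih => rw [pow_succ, ih, fromBlocks_multiply]; simp [pow_succ]
  induction q using Polynomial.induction_on' with
  | add p q hp hq => simp [hp, hq, fromBlocks_add]
  | monomial n a =>
    simp only [aeval_monomial, Algebra.algebraMap_eq_smul_one, smul_mul_assoc, one_mul]
    rw [hp, fromBlocks_smul]; simp

lemma aux_cfc {k l : ℕ} (f : ℝ → ℝ) (A B : Matrix (Fin k) (Fin k) ℝ)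
    (V : Matrix (Fin l) (Fin l) ℝ) (hA : A.IsHermitian) (hB : B.IsHermitian)
    (hV : V.IsHermitian) (W : Matrix (Fin l) (Fin k ⊕ Fin k) ℝ)
    (T : Matrix (Fin k ⊕ Fin k) (Fin l) ℝ) (hWT : W * T = 1)
    (h : V * W = W * fromBlocks A 0 0 B) :
    cfc f V = W * fromBlocks (cfc f A) 0 0 (cfc f B) * T := by
  obtain ⟨q, h1, h2, h3⟩ := aux_poly f A B V hA hB hV
  rw [h1, h2, h3, ← aux_blocks, ← aux_intertwine _ _ _ h, Matrix.mul_assoc, hWT, Matrix.mul_one]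

lemma aux_pos_spec {k : ℕ} {A : Matrix (Fin k) (Fin k) ℝ} (hA : A.PosDef) :
    ∀ x ∈ spectrum ℝ A, 0 < x := by
  rw [hA.isHermitian.spectrum_real_eq_range_eigenvalues]
  rintro _ ⟨i, rfl⟩
  exact hA.eigenvalues_pos i

lemma aux_cont {k : ℕ} {A : Matrix (Fin k) (Fin k) ℝ} (hA : A.PosDef) (f : ℝ → ℝ) :
    ContinuousOn f (spectrum ℝ A) := by
  have : (spectrum ℝ A).Finite := by
    rw [hA.isHermitian.spectrum_real_eq_range_eigenvalues]; exact Set.finite_range _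
  exact this.continuousOn f

lemma aux_sqrt {k : ℕ} {A : Matrix (Fin k) (Fin k) ℝ} (hA : A.PosDef) :
    mpow A (1/2) * mpow A (1/2) = A := by
  unfold mpow
  rw [← cfc_mul _ _ A (aux_cont hA _) (aux_cont hA _)]
  conv_rhs => rw [← cfc_id' ℝ A hA.isHermitian]
  refine cfc_congr fun x hx => ?_
  have := aux_pos_spec hA x hx
  rw [← Real.rpow_add this]; norm_num

lemma aux_inv {k : ℕ} {A : Matrix (Fin k) (Fin k) ℝ} (hA : A.PosDef) :
    mpow A (1/2) * mpow A (-(1/2)) = 1 := by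
  unfold mpow
  rw [← cfc_mul _ _ A (aux_cont hA _) (aux_cont hA _)]
  rw [← cfc_const_one ℝ A hA.isHermitian]
  refine cfc_congr fun x hx => ?_
  have := aux_pos_spec hA x hx
  rw [← Real.rpow_add this]; norm_num

lemma aux_posdef {k : ℕ} {A : Matrix (Fin k) (Fin k) ℝ} (hA : A.PosDef) :
    (mpow A (1/2)).PosDef := by
  unfold mpow
  have hH : (cfc (fun x : ℝ => x ^ (1/2 : ℝ)) A).IsHermitian :=
    cfc_predicate (p := IsSelfAdjoint) (R := ℝ) _ A
  rw [hH.posDef_iff_eigenvalues_pos]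
  intro i
  have h := hH.eigenvalues_mem_spectrum_real i
  rw [cfc_map_spectrum (p := IsSelfAdjoint) (R := ℝ) _ A hA.isHermitian (aux_cont hA _)] at h
  obtain ⟨x, hx, hxe⟩ := h
  rw [← hxe]
  exact Real.rpow_pos_of_pos (aux_pos_spec hA x hx) _

lemma aux_trace {k : ℕ} {A : Matrix (Fin k) (Fin k) ℝ} (hA : A.PosDef) :
    (mlogb2 A).trace = Real.logb 2 A.det := by
  unfold mlogb2
  rw [hA.isHermitian.cfc_eq, Matrix.IsHermitian.cfc, Unitary.conjStarAlgAut_apply,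
    Matrix.trace_mul_comm, ← Matrix.mul_assoc, Unitary.coe_star_mul_self, Matrix.one_mul,
    Matrix.trace_diagonal, hA.isHermitian.det_eq_prod_eigenvalues]
  simp only [Function.comp, RCLike.ofReal_real_eq_id, id]
  rw [Real.logb_prod _ _ fun i _ => (hA.eigenvalues_pos i).ne']

lemma aux_root {k : ℕ} {A B X Y Xi : Matrix (Fin k) (Fin k) ℝ} (hX : X.PosDef) (hY : Y.PosDef)
    (hXA : X * X = A) (hYB : Y * Y = B) (hi : X * Xi = 1) {μ : ℝ}
    (hμ : μ ∈ (Xi * Y).charpoly.roots) :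
    0 < μ ∧ ((A - B).PosSemidef → μ ≤ 1) ∧ ((B - A).PosSemidef → 1 ≤ μ) := by
  have hr := (mem_roots'.1 hμ).2
  rw [IsRoot, Matrix.eval_charpoly] at hr
  obtain ⟨w, hw0, hw⟩ := Matrix.exists_mulVec_eq_zero_iff.2 hr
  have hw1 : Y *ᵥ w = μ • (X *ᵥ w) := by
    have h2 := congrArg (fun z => X *ᵥ z) hw
    simp only [Matrix.sub_mulVec, Matrix.mulVec_sub, Matrix.mulVec_zero] at h2
    rw [Matrix.mulVec_mulVec, Matrix.mulVec_mulVec, ← Matrix.mul_assoc, hi, Matrix.one_mul,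
      sub_eq_zero] at h2
    rw [← h2, ← Matrix.mulVec_smul, ← Matrix.mulVec_mulVec]
    congr 1
    ext i
    simp [Matrix.mulVec_diagonal, Matrix.scalar_apply]
  have hx : 0 < w ⬝ᵥ (X *ᵥ w) := by simpa using hX.dotProduct_mulVec_pos hw0
  have hy : 0 < w ⬝ᵥ (Y *ᵥ w) := by simpa using hY.dotProduct_mulVec_pos hw0
  have hpos : 0 < μ := by
    rw [hw1, dotProduct_smul, smul_eq_mul] at hy
    exact pos_of_mul_pos_left hy hx.le
  have sym : ∀ Z : Matrix (Fin k) (Fin k) ℝ, Z.IsHermitian →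
      w ⬝ᵥ ((Z * Z) *ᵥ w) = (Z *ᵥ w) ⬝ᵥ (Z *ᵥ w) := by
    intro Z hZ
    have hZ' : Zᵀ = Z := by simpa using hZ.eq
    rw [← Matrix.mulVec_mulVec, Matrix.dotProduct_mulVec]
    congr 1
    rw [← Matrix.mulVec_transpose, hZ']
  have hne : 0 < (X *ᵥ w) ⬝ᵥ (X *ᵥ w) := by
    have h0 : X *ᵥ w ≠ 0 := fun h => by simp [h] at hx
    have h1 : 0 ≤ (X *ᵥ w) ⬝ᵥ (X *ᵥ w) := by
      simpa using dotProduct_star_self_nonneg (X *ᵥ w)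
    exact lt_of_le_of_ne h1 fun h => h0 (dotProduct_self_eq_zero.1 h.symm)
  have hA := sym X hX.isHermitian
  have hB := sym Y hY.isHermitian
  rw [hXA] at hA
  rw [hYB, hw1, dotProduct_smul, smul_dotProduct, smul_eq_mul, smul_eq_mul] at hB
  refine ⟨hpos, fun h => ?_, fun h => ?_⟩
  · have := h.dotProduct_mulVec_nonneg w
    simp only [star_trivial, Matrix.sub_mulVec, dotProduct_sub, hA, hB] at this
    by_contra! hc
    nlinarith [mul_pos hne (sub_pos.2 hc), mul_pos (mul_pos hne (sub_pos.2 hc)) hpos]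
  · have := h.dotProduct_mulVec_nonneg w
    simp only [star_trivial, Matrix.sub_mulVec, dotProduct_sub, hA, hB] at this
    by_contra! hc
    nlinarith [mul_pos hne (sub_pos.2 hc), mul_pos (mul_pos hne (sub_pos.2 hc)) hpos]

lemma aux_det {k : ℕ} {A B : Matrix (Fin k) (Fin k) ℝ} (hA : A.PosDef) (hB : B.PosDef) :
    Real.logb 2 (mpow A (-(1/2)) * mpow B (1/2)).det =
      (Real.logb 2 B.det - Real.logb 2 A.det) / 2 := by
  have hx := (aux_posdef hA).det_pos
  have hy := (aux_posdef hB).det_pos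
  have h1 := congrArg Matrix.det (aux_inv hA)
  rw [Matrix.det_mul, Matrix.det_one] at h1
  have h2 : (mpow A (-(1/2))).det = (mpow A (1/2)).det⁻¹ := by
    field_simp; linarith
  rw [Matrix.det_mul, h2, Real.logb_mul (inv_ne_zero hx.ne') hy.ne', Real.logb_inv]
  conv_rhs => rw [← aux_sqrt hA, ← aux_sqrt hB]
  rw [Matrix.det_mul, Matrix.det_mul, Real.logb_mul hx.ne' hx.ne', Real.logb_mul hy.ne' hy.ne']
  ring

/-- the core computation when `A ≥ B` -/
lemma aux_core {k n : ℕ} {A B : Matrix (Fin k) (Fin k) ℝ} (hA : A.PosDef) (hB : B.PosDef)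
    (hAB : (A - B).PosSemidef) (lam : Fin n → ℝ)
    (h : (mpow A (-(1/2)) * mpow B (1/2)).charpoly * (mpow B (-(1/2)) * mpow A (1/2)).charpoly =
      ∏ j, (X - C (lam j))) :
    -∑ j, Real.logb 2 (min 1 (lam j)) =
      |(mlogb2 A).trace - (mlogb2 B).trace| / 2 := by
  set M := mpow A (-(1/2)) * mpow B (1/2) with hM
  set M' := mpow B (-(1/2)) * mpow A (1/2) with hM'
  have hs : (M.charpoly * M'.charpoly).Splits := by
    rw [h]; exact Polynomial.Splits.prod fun _ _ => Polynomial.Splits.X_sub_C _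
  have hne : M.charpoly * M'.charpoly ≠ 0 :=
    mul_ne_zero M.charpoly_monic.ne_zero M'.charpoly_monic.ne_zero
  have hs1 : M.charpoly.Splits := hs.of_dvd hne (dvd_mul_right _ _)
  have hroots : M.charpoly.roots + M'.charpoly.roots = Finset.univ.val.map lam := by
    rw [← roots_mul hne, h]
    exact roots_multiset_prod_X_sub_C (Finset.univ.val.map lam) |> fun e => by
      rw [← e, Multiset.map_map]; rfl
  have hsum : ∑ j, Real.logb 2 (min 1 (lam j)) =
      (M.charpoly.roots.map fun x => Real.logb 2 (min 1 x)).sum +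
      (M'.charpoly.roots.map fun x => Real.logb 2 (min 1 x)).sum := by
    rw [← Multiset.sum_add, ← Multiset.map_add, hroots, Multiset.map_map]; rfl
  have r1 : ∀ x ∈ M.charpoly.roots, 0 < x ∧ x ≤ 1 := fun x hx => by
    have := aux_root (aux_posdef hA) (aux_posdef hB) (aux_sqrt hA) (aux_sqrt hB) (aux_inv hA) hx
    exact ⟨this.1, this.2.1 hAB⟩
  have r2 : ∀ x ∈ M'.charpoly.roots, 1 ≤ x := fun x hx => by
    have := aux_root (aux_posdef hB) (aux_posdef hA) (aux_sqrt hB) (aux_sqrt hA) (aux_inv hB) hx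
    exact this.2.2 hAB
  have e2 : (M'.charpoly.roots.map fun x => Real.logb 2 (min 1 x)).sum = 0 := by
    apply Multiset.sum_eq_zero
    intro y hy
    obtain ⟨x, hx, rfl⟩ := Multiset.mem_map.1 hy
    rw [min_eq_left (r2 x hx), Real.logb_one]
  have key : ∀ s : Multiset ℝ, (∀ x ∈ s, 0 < x ∧ x ≤ 1) →
      0 < s.prod ∧ (s.map fun x => Real.logb 2 (min 1 x)).sum = Real.logb 2 s.prod ∧
      Real.logb 2 s.prod ≤ 0 := by
    intro s
    induction s using Multiset.induction_on with
    | empty => simp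
    | cons a s ih =>
      intro hh
      obtain ⟨p1, p2, p3⟩ := ih fun x hx => hh x (Multiset.mem_cons_of_mem hx)
      obtain ⟨a1, a2⟩ := hh a (Multiset.mem_cons_self a s)
      have := Real.logb_nonpos (b := 2) (by norm_num) a1.le a2
      rw [Multiset.prod_cons, Multiset.map_cons, Multiset.sum_cons, p2, min_eq_right a2,
        Real.logb_mul a1.ne' p1.ne']
      exact ⟨mul_pos a1 p1, rfl, by linarith⟩
  obtain ⟨-, k2, k3⟩ := key _ r1
  rw [← Matrix.det_eq_prod_roots_charpoly_of_splits hs1, hM, aux_det hA hB] at k2 k3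
  rw [hsum, e2, k2, aux_trace hA, aux_trace hB, abs_of_nonneg (by linarith)]
  ring

lemma aux_flip_mul {k : ℕ} (M : Matrix (Fin k) (Fin k) ℝ) (i j : Fin k) :
    (flipMat k * M) i j = M (Fin.rev i) j := by
  rw [Matrix.mul_apply, Finset.sum_eq_single (Fin.rev i)]
  · have : (i : ℕ) + (Fin.rev i : ℕ) = k - 1 := by rw [Fin.val_rev]; omega
    simp [flipMat, -Fin.val_rev, this]
  · intro b _ hb
    have : ¬ ((i : ℕ) + (b : ℕ) = k - 1) := fun h => hb (Fin.ext (by rw [Fin.val_rev]; omega))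
    simp [flipMat, this]
  · simp

lemma aux_mul_flip {k : ℕ} (M : Matrix (Fin k) (Fin k) ℝ) (i j : Fin k) :
    (M * flipMat k) i j = M i (Fin.rev j) := by
  rw [Matrix.mul_apply, Finset.sum_eq_single (Fin.rev j)]
  · have : (Fin.rev j : ℕ) + (j : ℕ) = k - 1 := by rw [Fin.val_rev]; omega
    simp [flipMat, -Fin.val_rev, this]
  · intro b _ hb
    have : ¬ ((b : ℕ) + (j : ℕ) = k - 1) := fun h => hb (Fin.ext (by rw [Fin.val_rev]; omega))
    simp [flipMat, this]
  · simp

lemma aux_flip_flip (k : ℕ) : flipMat k * flipMat k = 1 := by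
  ext i j
  rw [aux_flip_mul]
  simp only [flipMat, of_apply, Fin.val_rev, Matrix.one_apply, Fin.ext_iff]
  congr 1
  apply propext
  omega

lemma aux_flip_transpose (k : ℕ) : (flipMat k)ᵀ = flipMat k := by
  ext i j
  simp [flipMat, Nat.add_comm]

lemma aux_of_blocks {m : ℕ} (M : Matrix (Fin (m + m)) (Fin (m + m)) ℝ)
    (a b c d : Matrix (Fin m) (Fin m) ℝ)
    (ha : ∀ i j, M (Fin.castAdd m i) (Fin.castAdd m j) = a i j)
    (hb : ∀ i j, M (Fin.castAdd m i) (Fin.natAdd m j) = b i j)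
    (hc : ∀ i j, M (Fin.natAdd m i) (Fin.castAdd m j) = c i j)
    (hd : ∀ i j, M (Fin.natAdd m i) (Fin.natAdd m j) = d i j) :
    M = (fromBlocks a b c d).submatrix finSumFinEquiv.symm finSumFinEquiv.symm := by
  have : M.submatrix finSumFinEquiv finSumFinEquiv = fromBlocks a b c d := by
    ext i j
    rcases i with i | i <;> rcases j with j | j
    · exact ha i j
    · exact hb i j
    · exact hc i j
    · exact hd i j
  rw [← this]
  simp

lemma aux_flip_blocks (m : ℕ) : flipMat (m + m) =
    (fromBlocks 0 (flipMat m) (flipMat m) 0).submatrix finSumFinEquiv.symm finSumFinEquiv.symm := by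
  apply aux_of_blocks <;> intro i j <;>
    simp only [flipMat, of_apply, Fin.val_castAdd, Fin.val_natAdd, Matrix.zero_apply]
  · rw [if_neg (by omega)]
  · congr 1; apply propext; omega
  · congr 1; apply propext; omega
  · rw [if_neg (by omega)]

lemma aux_P_blocks (m : ℕ) :
    Matrix.diagonal (fun i : Fin (m + m) => if (i : ℕ) < m then (1 : ℝ) else -1) =
    (fromBlocks (1 : Matrix (Fin m) (Fin m) ℝ) 0 0 (-1)).submatrix
      finSumFinEquiv.symm finSumFinEquiv.symm := by
  apply aux_of_blocks <;> intro i j <;>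
    simp only [Matrix.diagonal_apply, Matrix.neg_apply, Matrix.one_apply, Fin.ext_iff,
      Fin.val_castAdd, Fin.val_natAdd, Matrix.zero_apply]
  · rw [if_pos i.2]
  · rw [if_neg (by omega)]
  · rw [if_neg (by omega)]
  · rw [if_neg (show ¬ (m + (i : ℕ) < m) by omega)]
    split_ifs <;> first | omega | simp

lemma aux_V_blocks (m : ℕ) (hm : 0 < m)
    (v : Fin (m + m) → ℝ) (hv : ∀ l, v (-l) = v l)
    (V : Matrix (Fin (m + m)) (Fin (m + m)) ℝ) (hV : V = Matrix.circulant v)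
    (V₁ V₂ : Matrix (Fin m) (Fin m) ℝ)
    (hV₁ : ∀ i j, V₁ i j = V (Fin.castAdd m i) (Fin.castAdd m j))
    (hV₂ : ∀ i j, V₂ i j = V (Fin.castAdd m i) (Fin.natAdd m j)) :
    V = (fromBlocks V₁ V₂ V₂ V₁).submatrix finSumFinEquiv.symm finSumFinEquiv.symm ∧
    V₁ * flipMat m = flipMat m * V₁ ∧ V₂ * flipMat m = flipMat m * V₂ := by
  have : NeZero (m + m) := ⟨by omega⟩
  have key : ∀ a b c d : Fin (m + m),
      ((a : ℕ) + d) % (m + m) = ((c : ℕ) + b) % (m + m) → v (a - b) = v (c - d) := by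
    intro a b c d h
    congr 1
    rw [sub_eq_sub_iff_add_eq_add]
    exact Fin.ext (by rw [Fin.val_add, Fin.val_add, h])
  have key' : ∀ a b c d : Fin (m + m),
      ((a : ℕ) + c) % (m + m) = ((d : ℕ) + b) % (m + m) → v (a - b) = v (c - d) := by
    intro a b c d h
    rw [← hv (c - d), neg_sub]
    exact key _ _ _ _ h
  subst hV
  simp only [circulant_apply] at hV₁ hV₂
  refine ⟨?_, ?_, ?_⟩
  · apply aux_of_blocks <;> intro i j <;> simp only [hV₁, hV₂, circulant_apply]
    · apply key
      simp only [Fin.val_castAdd, Fin.val_natAdd]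
      rw [show m + (i : ℕ) + (m + j) = i + j + (m + m) by omega, Nat.add_mod_right]
    · apply key
      simp only [Fin.val_castAdd, Fin.val_natAdd]
      congr 1; omega
  · ext i j
    rw [aux_mul_flip, aux_flip_mul, hV₁, hV₁]
    apply key'
    simp only [Fin.val_castAdd, Fin.val_rev]
    congr 1; omega
  · ext i j
    rw [aux_mul_flip, aux_flip_mul, hV₂, hV₂]
    apply key'
    simp only [Fin.val_castAdd, Fin.val_natAdd, Fin.val_rev]
    rw [show m + (j : ℕ) + (m + (m - (j + 1))) = (m - (j+1) + j) + (m + m) by omega,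
      Nat.add_mod_right]
    congr 1; omega

lemma aux_W (m : ℕ) : ∃ (W : Matrix (Fin (m + m)) (Fin m ⊕ Fin m) ℝ)
    (T : Matrix (Fin m ⊕ Fin m) (Fin (m + m)) ℝ), W * T = 1 ∧ T * W = 1 ∧ Wᴴ * W = (2 : ℝ) • 1 ∧
    (∀ V₁ V₂ : Matrix (Fin m) (Fin m) ℝ, V₁ * flipMat m = flipMat m * V₁ →
      V₂ * flipMat m = flipMat m * V₂ →
      (fromBlocks V₁ V₂ V₂ V₁).submatrix finSumFinEquiv.symm finSumFinEquiv.symm * W =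
      W * fromBlocks (V₁ + V₂ * flipMat m) 0 0 (V₁ - V₂ * flipMat m)) ∧
    Matrix.diagonal (fun i : Fin (m + m) => if (i : ℕ) < m then (1 : ℝ) else -1) * W =
      W * (fromBlocks 0 1 1 0 : Matrix (Fin m ⊕ Fin m) (Fin m ⊕ Fin m) ℝ) ∧
    flipMat (m + m) * W = W * (fromBlocks 1 0 0 (-1) : Matrix (Fin m ⊕ Fin m) (Fin m ⊕ Fin m) ℝ) := by
  set F := flipMat m with hF
  have hFF : F * F = 1 := aux_flip_flip m
  have hFT : Fᵀ = F := aux_flip_transpose m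
  have e1 : ∀ (M N : Matrix (Fin m ⊕ Fin m) (Fin m ⊕ Fin m) ℝ),
      M.submatrix finSumFinEquiv.symm finSumFinEquiv.symm * N.submatrix finSumFinEquiv.symm id =
        (M * N).submatrix (finSumFinEquiv (m := m) (n := m)).symm id := fun M N =>
    Matrix.submatrix_mul_equiv M N _ _ _
  have e2 : ∀ (M N : Matrix (Fin m ⊕ Fin m) (Fin m ⊕ Fin m) ℝ),
      M.submatrix (finSumFinEquiv (m := m) (n := m)).symm id * N =
        (M * N).submatrix (finSumFinEquiv (m := m) (n := m)).symm id := fun M N => by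
    ext i j; simp [Matrix.mul_apply]
  have e3 : ∀ (M N : Matrix (Fin m ⊕ Fin m) (Fin m ⊕ Fin m) ℝ),
      M.submatrix id finSumFinEquiv.symm * N.submatrix finSumFinEquiv.symm id =
        M * N := fun M N => by
    rw [Matrix.submatrix_mul_equiv, Matrix.submatrix_id_id]
  have e4 : ∀ (M N : Matrix (Fin m ⊕ Fin m) (Fin m ⊕ Fin m) ℝ), M * N = 1 →
      M.submatrix (finSumFinEquiv (m := m) (n := m)).symm id *
        N.submatrix id (finSumFinEquiv (m := m) (n := m)).symm = 1 := fun M N h => by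
    have : M.submatrix (finSumFinEquiv (m := m) (n := m)).symm id *
        N.submatrix id (finSumFinEquiv (m := m) (n := m)).symm =
        (M * N).submatrix finSumFinEquiv.symm finSumFinEquiv.symm := by
      ext i j; simp [Matrix.mul_apply]
    rw [this, h, Matrix.submatrix_one_equiv]
  have hTW : ((1 / 2 : ℝ) • fromBlocks 1 F 1 (-F)) * fromBlocks 1 1 F (-F) = 1 := by
    rw [Matrix.smul_mul, fromBlocks_multiply, fromBlocks_smul, ← fromBlocks_one]
    congr 1 <;> simp [hFF] <;> rw [← add_smul] <;>
      norm_num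
  refine ⟨(fromBlocks 1 1 F (-F)).submatrix finSumFinEquiv.symm id,
    ((1 / 2 : ℝ) • fromBlocks 1 F 1 (-F)).submatrix id finSumFinEquiv.symm, ?_, ?_, ?_, ?_, ?_, ?_⟩
  · exact e4 _ _ (mul_eq_one_comm.1 hTW)
  · rw [e3, hTW]
  · rw [Matrix.conjTranspose_submatrix, e3, ← hTW, ← Matrix.smul_mul, smul_smul]
    norm_num
    rw [Matrix.fromBlocks_transpose]
    simp [hFT]
  · intro V₁ V₂ h1 h2
    rw [e1, e2, fromBlocks_multiply, fromBlocks_multiply]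
    congr 2 <;> simp [Matrix.mul_add, Matrix.mul_sub, ← Matrix.mul_assoc, ← h1, ← h2]
    · abel
    · rw [Matrix.mul_assoc V₂, hFF, Matrix.mul_one, add_comm]
    · rw [Matrix.mul_assoc V₂, hFF, Matrix.mul_one]; abel
  · rw [aux_P_blocks, e1, e2, fromBlocks_multiply, fromBlocks_multiply]
    congr 2 <;> simp
  · rw [aux_flip_blocks, e1, e2, fromBlocks_multiply, fromBlocks_multiply]
    congr 2 <;> simp [← hF, hFF]

/-- **Theorem 1, equality case.** For `n = m + m` even positive
and `V` circulant symmetric positive definite with blocks `[[V', V''], [V'', V']]`,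
if `V''F` is positive semidefinite or negative semidefinite, then the
logarithmic negativity `N = -∑ⱼ log₂ min(1, λⱼ)` of the symmetrically bisected
chain (with `λⱼ` the eigenvalues of `Q = V^{-1/2} P V^{1/2} P`) satisfies
`N = |Tr(F_n log₂ V)| / 2`. -/
theorem logneg_eq_half_abs_trace_flip_log_of_semidef
    (m : ℕ) (hm : 0 < m)
    (v : Fin (m + m) → ℝ) (hv : ∀ l, v (-l) = v l)
    (V : Matrix (Fin (m + m)) (Fin (m + m)) ℝ) (hV : V = Matrix.circulant v)
    (hVpd : V.PosDef)
    (V₁ V₂ : Matrix (Fin m) (Fin m) ℝ)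
    (hV₁ : ∀ i j, V₁ i j = V (Fin.castAdd m i) (Fin.castAdd m j))
    (hV₂ : ∀ i j, V₂ i j = V (Fin.castAdd m i) (Fin.natAdd m j))
    (hsemidef : (V₂ * flipMat m).PosSemidef ∨ (-(V₂ * flipMat m)).PosSemidef)
    (P : Matrix (Fin (m + m)) (Fin (m + m)) ℝ)
    (hP : P = Matrix.diagonal (fun i : Fin (m + m) => if (i : ℕ) < m then (1 : ℝ) else -1))
    (Q : Matrix (Fin (m + m)) (Fin (m + m)) ℝ)
    (hQ : Q = mpow V (-(1/2)) * P * mpow V (1/2) * P)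
    (lam : Fin (m + m) → ℝ)
    (hlam : Q.charpoly = ∏ j : Fin (m + m), (X - C (lam j)))
    (N : ℝ) (hN : N = -∑ j : Fin (m + m), Real.logb 2 (min 1 (lam j))) :
    N = |(flipMat (m + m) * mlogb2 V).trace| / 2 := by
  obtain ⟨hb, h1, h2⟩ := aux_V_blocks m hm v hv V hV V₁ V₂ hV₁ hV₂
  obtain ⟨W, T, hWT, hTW, hWW, hWV, hWP, hWF⟩ := aux_W m
  have hVW := hWV V₁ V₂ h1 h2
  rw [← hb] at hVW
  rw [← hP] at hWP
  clear hWV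
  set A := V₁ + V₂ * flipMat m with hAdef
  set B := V₁ - V₂ * flipMat m with hBdef
  have hDpd : (fromBlocks A 0 0 B).PosDef := by
    have hinj : Function.Injective W.mulVec := by
      intro x y hxy
      have := congrArg (fun z => T *ᵥ z) hxy
      simpa [Matrix.mulVec_mulVec, hTW] using this
    have := hVpd.conjTranspose_mul_mul_same hinj
    rw [Matrix.mul_assoc, hVW, ← Matrix.mul_assoc, hWW, Matrix.smul_mul, Matrix.one_mul] at this
    have h3 := this.smul (show (0 : ℝ) < 1 / 2 by norm_num)
    rw [smul_smul] at h3
    norm_num at h3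
    exact h3
  have hA : A.PosDef := hDpd.submatrix (e := Sum.inl) Sum.inl_injective
  have hB : B.PosDef := hDpd.submatrix (e := Sum.inr) Sum.inr_injective
  have hcfc := fun f : ℝ → ℝ => aux_cfc f A B V hA.isHermitian hB.isHermitian hVpd.isHermitian
    W T hWT hVW
  have hcfcW : ∀ f : ℝ → ℝ, cfc f V * W = W * fromBlocks (cfc f A) 0 0 (cfc f B) := fun f => by
    rw [hcfc f, Matrix.mul_assoc, hTW, Matrix.mul_one]
  have hp : ∀ p : ℝ, mpow V p * W = W * fromBlocks (mpow A p) 0 0 (mpow B p) := fun p => hcfcW _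
  have hl : mlogb2 V * W = W * fromBlocks (mlogb2 A) 0 0 (mlogb2 B) := hcfcW _
  have htr : (flipMat (m + m) * mlogb2 V).trace = (mlogb2 A).trace - (mlogb2 B).trace := by
    have : (flipMat (m + m) * mlogb2 V) = W * ((fromBlocks 1 0 0 (-1) : Matrix (Fin m ⊕ Fin m) (Fin m ⊕ Fin m) ℝ) *
        fromBlocks (mlogb2 A) 0 0 (mlogb2 B)) * T := by
      rw [← Matrix.mul_assoc, ← hWF, Matrix.mul_assoc (flipMat (m + m)), ← hl, ← Matrix.mul_assoc,
        Matrix.mul_assoc _ W T, hWT, Matrix.mul_one]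
    rw [this, Matrix.trace_mul_comm, ← Matrix.mul_assoc, hTW, Matrix.one_mul, fromBlocks_multiply]
    simp [Matrix.trace, sub_eq_add_neg]
  have hQW : Q * W = W * fromBlocks (mpow A (-(1/2)) * mpow B (1/2)) 0 0
      (mpow B (-(1/2)) * mpow A (1/2)) := by
    rw [hQ, Matrix.mul_assoc _ P W, hWP, ← Matrix.mul_assoc, Matrix.mul_assoc _ (mpow V (1/2)) W,
      hp, ← Matrix.mul_assoc, Matrix.mul_assoc _ P W, hWP, ← Matrix.mul_assoc, hp,
      Matrix.mul_assoc, Matrix.mul_assoc, Matrix.mul_assoc, fromBlocks_multiply,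
      fromBlocks_multiply, fromBlocks_multiply]
    simp
  have hch : Q.charpoly = (mpow A (-(1/2)) * mpow B (1/2)).charpoly *
      (mpow B (-(1/2)) * mpow A (1/2)).charpoly := by
    have : Q = (Q * W) * T := by rw [Matrix.mul_assoc, hWT, Matrix.mul_one]
    rw [this, Matrix.charpoly_mul_comm_of_le _ _ (by simp), hQW, ← Matrix.mul_assoc, hTW,
      Matrix.one_mul, charpoly_fromBlocks_zero₁₂]
    simp
  rw [hch] at hlam
  have hAB : A - B = (2 : ℝ) • (V₂ * flipMat m) := by
    rw [two_smul, hAdef, hBdef]; abel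
  have hBA : B - A = (2 : ℝ) • (-(V₂ * flipMat m)) := by
    rw [two_smul, hAdef, hBdef]; abel
  rw [hN, htr]
  rcases hsemidef with h | h
  · exact aux_core hA hB (hAB ▸ h.smul (by norm_num)) lam hlam
  · rw [abs_sub_comm]
    rw [mul_comm] at hlam
    exact aux_core hB hA (hBA ▸ h.smul (by norm_num)) lam hlam
end

section
/- (Corollary 1) Let n ≥ 4 be an even integer, α ≥ 0 a real number, and let V be the n×n real circulant symmetric matrix with first column v_0 = 1 + 2α, v_1 = v_{n−1} = −α, and v_j = 0 for 1 < j < n − 1 (the nearest-neighbor potential matrix). Then V is positive definite and the logarithmic negativity of the symmetrically bisected chain equals N(V) = (1/2) log₂(1 + 4α); in particular N(V) is independent of the chain length n. -/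
open Matrix Polynomial

lemma aux_mpow_mul {k : ℕ} {V : Matrix (Fin k) (Fin k) ℝ} (hV : V.PosDef) (p q : ℝ) :
    mpow V p * mpow V q = mpow V (p + q) := by
  have hs : ∀ x ∈ spectrum ℝ V, 0 < x := by
    intro x hx
    rw [hV.1.spectrum_real_eq_range_eigenvalues] at hx
    obtain ⟨i, rfl⟩ := hx
    exact hV.eigenvalues_pos i
  have hc : ∀ r : ℝ, ContinuousOn (fun x : ℝ => x ^ r) (spectrum ℝ V) := by
    intro r x hx
    exact (Real.continuousAt_rpow_const x r (Or.inl (hs x hx).ne')).continuousWithinAt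
  unfold mpow
  rw [← cfc_mul _ _ V (hc p) (hc q)]
  apply cfc_congr
  intro x hx
  exact (Real.rpow_add (hs x hx) p q).symm

lemma aux_mpow_herm {k : ℕ} (V : Matrix (Fin k) (Fin k) ℝ) (p : ℝ) :
    (mpow V p)ᴴ = mpow V p := by
  have : IsSelfAdjoint (cfc (fun x : ℝ => x ^ p) V) := cfc_predicate _ _
  exact this

lemma aux_mpow_one {k : ℕ} {V : Matrix (Fin k) (Fin k) ℝ} (hV : V.PosDef) :
    mpow V 1 = V := by
  have h : IsSelfAdjoint V := hV.1
  unfold mpow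
  simp only [Real.rpow_one]
  exact cfc_id' ℝ V

lemma aux_mpow_zero {k : ℕ} {V : Matrix (Fin k) (Fin k) ℝ} (hV : V.PosDef) :
    mpow V 0 = 1 := by
  have h : IsSelfAdjoint V := hV.1
  unfold mpow
  simp only [Real.rpow_zero]
  exact cfc_const_one ℝ V

lemma aux_mpow_posDef {k : ℕ} {V : Matrix (Fin k) (Fin k) ℝ} (hV : V.PosDef) :
    (mpow V (1/2)).PosDef := by
  have h1 : (mpow V (1/2)).PosSemidef := by
    have := posSemidef_conjTranspose_mul_self (mpow V (1/4))
    rw [aux_mpow_herm, aux_mpow_mul hV] at this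
    norm_num at this ⊢
    exact this
  rw [h1.posDef_iff_isUnit]
  have h2 : mpow V (1/2) * mpow V (-(1/2)) = 1 := by
    rw [aux_mpow_mul hV, add_neg_cancel, aux_mpow_zero hV]
  exact IsUnit.of_mul_eq_one _ h2

section abs
variable {m : Type*} [Fintype m] [DecidableEq m]

lemma aux_pencil {A B : Matrix m m ℝ} (hA : A.PosDef) (hB : B.PosDef) {x : m → ℝ} {μ : ℝ}
    (hx : x ≠ 0) (h : A *ᵥ x = μ • (B *ᵥ x)) :
    0 < μ ∧ μ ^ 2 * (x ⬝ᵥ (B * B) *ᵥ x) = x ⬝ᵥ (A * A) *ᵥ x ∧ 0 < x ⬝ᵥ (B * B) *ᵥ x := by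
  have a := hA.dotProduct_mulVec_pos hx
  have b := hB.dotProduct_mulVec_pos hx
  simp only [star_trivial] at a b
  have key : ∀ C : Matrix m m ℝ, C.PosDef → x ⬝ᵥ (C * C) *ᵥ x = (C *ᵥ x) ⬝ᵥ (C *ᵥ x) := by
    intro C hC
    have : Cᵀ = C := by
      have := hC.1.eq
      rwa [conjTranspose_eq_transpose_of_trivial] at this
    rw [← mulVec_mulVec, dotProduct_mulVec, ← mulVec_transpose, this]
  rw [h, dotProduct_smul, smul_eq_mul] at a
  refine ⟨pos_of_mul_pos_left a b.le, ?_, ?_⟩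
  · rw [key A hA, key B hB, h, dotProduct_smul, smul_dotProduct]
    simp only [smul_eq_mul]; ring
  · rw [key B hB]
    have hne : B *ᵥ x ≠ 0 := by
      intro h0; rw [h0] at b; simp at b
    have := dotProduct_star_self_pos_iff.mpr hne
    simpa using this

lemma aux_root_s12 {A B C : Matrix m m ℝ} (hBC : B * C = 1) {μ : ℝ}
    (h : μ ∈ (C * A).charpoly.roots) : ∃ x, x ≠ 0 ∧ A *ᵥ x = μ • (B *ᵥ x) := by
  have h1 := (mem_roots'.mp h).2
  rw [IsRoot, eval_charpoly, ← exists_mulVec_eq_zero_iff] at h1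
  obtain ⟨x, hx, h2⟩ := h1
  refine ⟨x, hx, ?_⟩
  rw [sub_mulVec, sub_eq_zero] at h2
  have h3 := congrArg (fun y => B *ᵥ y) h2
  simp only [mulVec_mulVec, ← mul_assoc, hBC, one_mul] at h3
  rw [← h3, ← mulVec_mulVec]
  simp [mulVec_smul]

lemma aux_charpoly (q r : Matrix m m ℝ) :
    (fromBlocks q r r q).charpoly = (q + r).charpoly * (q - r).charpoly := by
  let U : (Matrix (m ⊕ m) (m ⊕ m) ℝ)ˣ :=
    ⟨fromBlocks 1 0 (-1) 1, fromBlocks 1 0 1 1, by simp [fromBlocks_multiply],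
      by simp [fromBlocks_multiply]⟩
  rw [← charpoly_units_conj U, ← charpoly_fromBlocks_zero₂₁ _ r]
  congr 1
  rw [← coe_units_inv]
  change fromBlocks 1 0 (-1) 1 * fromBlocks q r r q * fromBlocks 1 0 1 1 = _
  simp [fromBlocks_multiply]
  abel

lemma aux_block {M : Matrix (m ⊕ m) (m ⊕ m) ℝ} (h : Commute M (fromBlocks 0 1 1 0)) :
    ∃ a b, M = fromBlocks a b b a := by
  have h' := h.eq
  rw [← fromBlocks_toBlocks M, fromBlocks_multiply, fromBlocks_multiply, fromBlocks_inj] at h'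
  simp at h'
  refine ⟨M.toBlocks₁₁, M.toBlocks₁₂, ?_⟩
  conv_lhs => rw [← fromBlocks_toBlocks M]
  rw [h'.1, ← h'.2.1]

lemma aux_pos {a b : Matrix m m ℝ} (h : (fromBlocks a b b a).PosDef) :
    (a + b).PosDef ∧ (a - b).PosDef := by
  have hH := h.1
  rw [IsHermitian, fromBlocks_conjTranspose, fromBlocks_inj] at hH
  obtain ⟨ha, hb, -, -⟩ := hH
  rw [posDef_iff_dotProduct_mulVec, posDef_iff_dotProduct_mulVec]
  refine ⟨⟨by rw [IsHermitian, conjTranspose_add, ha, hb], fun x hx => ?_⟩,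
    ⟨by rw [IsHermitian, conjTranspose_sub, ha, hb], fun x hx => ?_⟩⟩
  · have hne : Sum.elim x x ≠ 0 := by
      intro h0; apply hx; ext i; exact congrFun h0 (Sum.inl i)
    have := h.dotProduct_mulVec_pos hne
    simp only [star_trivial, fromBlocks_mulVec, sumElim_dotProduct_sumElim, Sum.elim_comp_inl, Sum.elim_comp_inr, dotProduct_add, add_mulVec] at this ⊢
    linarith
  · have hne : Sum.elim x (-x) ≠ 0 := by
      intro h0; apply hx; ext i; exact congrFun h0 (Sum.inl i)
    have := h.dotProduct_mulVec_pos hne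
    simp only [star_trivial, fromBlocks_mulVec, sumElim_dotProduct_sumElim, Sum.elim_comp_inl, Sum.elim_comp_inr, dotProduct_add, sub_mulVec, dotProduct_sub, mulVec_neg, neg_dotProduct, dotProduct_neg] at this ⊢
    linarith

lemma aux_main {T B : Matrix m m ℝ} {M Mi : Matrix (m ⊕ m) (m ⊕ m) ℝ}
    (hM : M.PosDef) (hMM : M * M = fromBlocks T B B T) (hMi : Mi * M = 1)
    (hc : Commute M (fromBlocks 0 1 1 0)) (hB : (-B).PosSemidef)
    {ι : Type*} [Fintype ι] (lam : ι → ℝ)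
    (hlam : (Mi * fromBlocks 1 0 0 (-1) * M * fromBlocks 1 0 0 (-1)).charpoly
      = ∏ j, (X - C (lam j))) :
    ∑ j, Real.logb 2 (min 1 (lam j)) = (1/2) * Real.logb 2 ((T + B).det / (T - B).det) := by
  have hMi' : M * Mi = 1 := mul_eq_one_comm.mp hMi
  have hci : Commute Mi (fromBlocks 0 1 1 0) := by
    have e := hc.eq
    have := congrArg (fun Z => Mi * Z * Mi) e
    simp only [← mul_assoc, hMi, one_mul] at this
    rw [mul_assoc _ M Mi, hMi', mul_one] at this
    exact this.symm
  obtain ⟨a, b, rfl⟩ := aux_block hc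
  obtain ⟨c, d, rfl⟩ := aux_block hci
  obtain ⟨hp, hm⟩ := aux_pos hM
  rw [fromBlocks_multiply, fromBlocks_inj] at hMM
  rw [fromBlocks_multiply, ← fromBlocks_one, fromBlocks_inj] at hMi'
  obtain ⟨e1, e2, -, -⟩ := hMM
  obtain ⟨f1, f2, -, -⟩ := hMi'
  have hpp : (a + b) * (a + b) = T + B := by rw [← e1, ← e2]; noncomm_ring
  have hmm : (a - b) * (a - b) = T - B := by rw [← e1, ← e2]; noncomm_ring
  have hpi : (a + b) * (c + d) = 1 := by
    rw [← add_zero (1 : Matrix m m ℝ), ← f2, ← f1]; noncomm_ring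
  have hmi : (a - b) * (c - d) = 1 := by
    rw [← sub_zero (1 : Matrix m m ℝ), ← f2, ← f1]; noncomm_ring
  have hQ : fromBlocks c d d c * fromBlocks 1 0 0 (-1) * fromBlocks a b b a * fromBlocks 1 0 0 (-1)
      = fromBlocks (c * a - d * b) (d * a - c * b) (d * a - c * b) (c * a - d * b) := by
    simp only [fromBlocks_multiply, fromBlocks_inj]
    refine ⟨?_, ?_, ?_, ?_⟩ <;> noncomm_ring
  rw [hQ, aux_charpoly] at hlam
  have g1 : c * a - d * b + (d * a - c * b) = (c + d) * (a - b) := by noncomm_ring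
  have g2 : c * a - d * b - (d * a - c * b) = (c - d) * (a + b) := by noncomm_ring
  rw [g1, g2] at hlam
  set p1 := ((c + d) * (a - b)).charpoly with hp1
  set p2 := ((c - d) * (a + b)).charpoly with hp2
  have hne : p1 * p2 ≠ 0 := ((charpoly_monic _).mul (charpoly_monic _)).ne_zero
  have hroots : p1.roots + p2.roots = Finset.univ.val.map lam := by
    rw [← roots_mul hne, hlam]
    have := roots_multiset_prod_X_sub_C (Finset.univ.val.map lam)
    rw [Multiset.map_map] at this
    exact this
  have hsp : p2.Splits := by
    apply Splits.of_dvd (g := p1 * p2) _ hne (Dvd.intro_left _ rfl)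
    rw [hlam]
    exact Splits.prod fun i _ => Splits.X_sub_C _
  have hdiff : ∀ x : m → ℝ, x ⬝ᵥ (T + B) *ᵥ x ≤ x ⬝ᵥ (T - B) *ᵥ x := by
    intro x
    have := hB.dotProduct_mulVec_nonneg x
    simp only [star_trivial, neg_mulVec, dotProduct_neg, add_mulVec, sub_mulVec, dotProduct_add, dotProduct_sub] at this ⊢
    linarith
  have r1 : ∀ μ ∈ p1.roots, 1 ≤ μ := by
    intro μ hμ
    obtain ⟨x, hx, h⟩ := aux_root_s12 hpi hμ
    obtain ⟨h0, h1, h2⟩ := aux_pencil hm hp hx h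
    rw [hpp, hmm] at h1
    rw [hpp] at h2
    have := hdiff x
    by_contra hlt
    push Not at hlt
    have : μ ^ 2 < 1 := by nlinarith
    nlinarith
  have r2 : ∀ μ ∈ p2.roots, 0 < μ ∧ μ ≤ 1 := by
    intro μ hμ
    obtain ⟨x, hx, h⟩ := aux_root_s12 hmi hμ
    obtain ⟨h0, h1, h2⟩ := aux_pencil hp hm hx h
    rw [hpp, hmm] at h1
    rw [hmm] at h2
    refine ⟨h0, ?_⟩
    have := hdiff x
    by_contra hlt
    push Not at hlt
    have : 1 < μ ^ 2 := by nlinarith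
    nlinarith
  have hsum : ∑ j, Real.logb 2 (min 1 (lam j))
      = ((p1.roots + p2.roots).map fun t => Real.logb 2 (min 1 t)).sum := by
    rw [hroots, Multiset.map_map]; rfl
  rw [hsum, Multiset.map_add, Multiset.sum_add]
  have s1 : (p1.roots.map fun t => Real.logb 2 (min 1 t)).sum = 0 := by
    apply Multiset.sum_eq_zero
    intro y hy
    obtain ⟨μ, hμ, rfl⟩ := Multiset.mem_map.mp hy
    rw [min_eq_left (r1 μ hμ), Real.logb_one]
  have s2' : ∀ s : Multiset ℝ, (∀ μ ∈ s, 0 < μ ∧ μ ≤ 1) →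
      0 < s.prod ∧ (s.map fun t => Real.logb 2 (min 1 t)).sum = Real.logb 2 s.prod := by
    intro s
    induction s using Multiset.induction_on with
    | empty => simp
    | cons t s ih =>
      intro h
      have ht := h t (by simp)
      obtain ⟨i1, i2⟩ := ih fun μ hμ => h μ (by simp [hμ])
      refine ⟨by rw [Multiset.prod_cons]; exact mul_pos ht.1 i1, ?_⟩
      rw [Multiset.map_cons, Multiset.sum_cons, Multiset.prod_cons, i2, min_eq_right ht.2,
        Real.logb_mul ht.1.ne' i1.ne']
  rw [s1, (s2' _ r2).2, zero_add, ← det_eq_prod_roots_charpoly_of_splits hsp]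
  have dp := hp.det_pos
  have dm := hm.det_pos
  have hmi' : (a - b).det * (c - d).det = 1 := by rw [← det_mul, hmi, det_one]
  have hcd : (c - d).det = 1 / (a - b).det := by field_simp; linarith
  rw [← hpp, ← hmm, det_mul, det_mul, det_mul, hcd]
  have : (a + b).det * (a + b).det / ((a - b).det * (a - b).det)
      = (1 / (a - b).det * (a + b).det) ^ 2 := by field_simp
  rw [this, Real.logb_pow]
  push_cast; ring

end abs

def auxD (k : ℕ) : Matrix (Fin k) (Fin (k + 1)) ℝ :=
  fun i j => (if j = i.succ then 1 else 0) - (if j = i.castSucc then 1 else 0)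

def auxE (k : ℕ) : Matrix (Fin (k + 1)) (Fin (k + 1)) ℝ :=
  diagonal fun i => if (i : ℕ) = 0 ∨ (i : ℕ) = k then 1 else 0

lemma auxDDt (k : ℕ) (i j : Fin k) : (auxD k * (auxD k)ᵀ) i j =
    if (i : ℕ) = j then 2 else if (i : ℕ) + 1 = j ∨ (j : ℕ) + 1 = i then -1 else 0 := by
  simp only [mul_apply, transpose_apply, auxD, sub_mul, ite_mul, one_mul, zero_mul,
    Finset.sum_sub_distrib, Finset.sum_ite_eq', Finset.sum_ite_eq, Finset.mem_univ, if_true]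
  simp only [Fin.ext_iff, Fin.val_succ, Fin.val_castSucc]
  split_ifs <;> first | omega | norm_num

lemma auxDtD (k : ℕ) (i j : Fin (k + 1)) : ((auxD k)ᵀ * auxD k) i j =
    if (i : ℕ) = j then (2 - if (i : ℕ) = 0 then 1 else 0) - (if (i : ℕ) = k then 1 else 0)
    else if (i : ℕ) + 1 = j ∨ (j : ℕ) + 1 = i then -1 else 0 := by
  have h1 : ∀ f : Fin k → ℝ, ∑ x : Fin k, (if i = x.succ then 1 else 0) * f x
      = if h : (i : ℕ) = 0 then 0 else f ⟨i - 1, by omega⟩ := by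
    intro f
    split_ifs with h
    · apply Finset.sum_eq_zero
      intro x _
      rw [if_neg, zero_mul]
      intro h'; rw [h'] at h; simp at h
    · rw [Finset.sum_eq_single ⟨i - 1, by omega⟩]
      · rw [if_pos, one_mul]
        ext; simp; omega
      · intro b _ hb
        rw [if_neg, zero_mul]
        intro h'; apply hb; ext; simp [h']
      · simp
  have h2 : ∀ f : Fin k → ℝ, ∑ x : Fin k, (if i = x.castSucc then 1 else 0) * f x
      = if h : (i : ℕ) = k then 0 else f ⟨i, by omega⟩ := by
    intro f
    split_ifs with h
    · apply Finset.sum_eq_zero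
      intro x _
      rw [if_neg, zero_mul]
      intro h'; rw [h'] at h; simp at h; omega
    · rw [Finset.sum_eq_single ⟨i, by omega⟩]
      · rw [if_pos, one_mul]
        ext; simp
      · intro b _ hb
        rw [if_neg, zero_mul]
        intro h'; apply hb; ext; simp [h']
      · simp
  simp only [mul_apply, transpose_apply, auxD]
  simp only [sub_mul, Finset.sum_sub_distrib, h1, h2]
  simp only [Fin.ext_iff, Fin.val_succ, Fin.val_castSucc]
  have hi := i.2
  have hj := j.2
  split_ifs <;> first | omega | norm_num

lemma aux_neg1 (a b : ℕ) (h : a + 1 = b ∨ b + 1 = a) : (-1 : ℝ) ^ a * (-1) ^ b = -1 := by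
  rw [← pow_add]
  apply Odd.neg_one_pow
  rcases h with h | h
  · exact ⟨a, by omega⟩
  · exact ⟨b, by omega⟩

lemma aux_neg2 (a : ℕ) : (-1 : ℝ) ^ a * (-1) ^ a = 1 := by
  rw [← pow_add]
  exact Even.neg_one_pow ⟨a, rfl⟩

def auxU (k : ℕ) : Matrix (Fin k) (Fin k) ℝ := diagonal fun i => (-1) ^ (i : ℕ)

lemma auxU_sq (k : ℕ) : auxU k * auxU k = 1 := by
  simp [auxU, aux_neg2]

lemma auxU_det (k : ℕ) (A : Matrix (Fin k) (Fin k) ℝ) : (auxU k * A * auxU k).det = A.det := by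
  have := congrArg det (auxU_sq k)
  rw [det_mul, det_one] at this
  rw [det_mul, det_mul]
  linear_combination A.det * this

lemma auxU1 (k : ℕ) (c a : ℝ) : auxU k * ((c + 4 * a) • 1 - a • (auxD k * (auxD k)ᵀ)) * auxU k
    = c • 1 + a • (auxD k * (auxD k)ᵀ) := by
  ext i j
  rw [auxU, mul_diagonal, diagonal_mul]
  simp only [Matrix.sub_apply, Matrix.add_apply, Matrix.smul_apply, auxDDt, Matrix.one_apply, Fin.ext_iff, smul_eq_mul]
  have h1 := aux_neg1 i j
  have h2 := aux_neg2 i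
  by_cases hij : (i : ℕ) = j
  · rw [← hij]
    simp
    linear_combination (c + 2 * a) * h2
  · by_cases h : (i : ℕ) + 1 = j ∨ (j : ℕ) + 1 = i
    · simp [hij, h]
      linear_combination a * h1 h
    · simp [hij, h]

lemma auxU2 (k : ℕ) (hk : 1 ≤ k) (c a : ℝ) :
    auxU (k+1) * ((c + 4 * a) • 1 - a • ((auxD k)ᵀ * auxD k)) * auxU (k+1)
    = c • 1 + a • ((auxD k)ᵀ * auxD k) + (2 * a) • auxE k := by
  ext i j
  rw [auxU, mul_diagonal, diagonal_mul]
  simp only [Matrix.sub_apply, Matrix.add_apply, Matrix.smul_apply, auxDtD, Matrix.one_apply, Fin.ext_iff, smul_eq_mul, auxE,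
    diagonal_apply]
  have h1 := aux_neg1 i j
  have h2 := aux_neg2 i
  by_cases hij : (i : ℕ) = j
  · rw [← hij]
    simp only [if_true]
    by_cases h0 : (i : ℕ) = 0
    · have : (i : ℕ) ≠ k := by omega
      simp only [h0, this, if_true, if_false, true_or]
      rw [if_neg (by omega)]
      simp; ring
    · by_cases hk : (i : ℕ) = k
      · simp only [h0, hk, or_true, if_true, if_false]
        rw [hk] at h2
        rw [if_neg (by omega)]
        linear_combination (c + 3 * a) * h2
      · simp only [h0, hk, or_self, if_false]
        linear_combination (c + 2 * a) * h2
  · by_cases h : (i : ℕ) + 1 = j ∨ (j : ℕ) + 1 = i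
    · simp [hij, h]
      linear_combination a * h1 h
    · simp [hij, h]

lemma aux_det_s12 (k : ℕ) (hk : 1 ≤ k) (a : ℝ) (ha : 0 ≤ a) :
    ((1 : Matrix (Fin (k+1)) (Fin (k+1)) ℝ) + a • ((auxD k)ᵀ * auxD k) + (2 * a) • auxE k).det
      = (1 + 4 * a) * (1 + a • ((auxD k)ᵀ * auxD k)).det := by
  have h2 := auxU2 k hk 1 a
  have h1 := auxU1 k 1 a
  rw [one_smul] at h1 h2
  have hc : (1 + 4 * a) ≠ 0 := by positivity
  have e1 : (1 + a • ((auxD k)ᵀ * auxD k)).det = (1 + a • (auxD k * (auxD k)ᵀ)).det := by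
    rw [← smul_mul, det_one_add_mul_comm, Matrix.mul_smul]
  have e2 : ((1 + 4 * a) • (1 : Matrix (Fin (k+1)) (Fin (k+1)) ℝ) - a • ((auxD k)ᵀ * auxD k)).det
      = (1 + 4 * a) * ((1 + 4 * a) • (1 : Matrix (Fin k) (Fin k) ℝ)
        - a • (auxD k * (auxD k)ᵀ)).det := by
    generalize 1 + 4 * a = c at hc
    have f1 : c • (1 : Matrix (Fin (k+1)) (Fin (k+1)) ℝ) - a • ((auxD k)ᵀ * auxD k)
        = c • (1 + ((-a / c) • (auxD k)ᵀ) * auxD k) := by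
      rw [smul_mul, smul_add, smul_smul, mul_div_cancel₀ _ hc, neg_smul, sub_eq_add_neg]
    have f2 : c • (1 : Matrix (Fin k) (Fin k) ℝ) - a • (auxD k * (auxD k)ᵀ)
        = c • (1 + auxD k * ((-a / c) • (auxD k)ᵀ)) := by
      rw [Matrix.mul_smul, smul_add, smul_smul, mul_div_cancel₀ _ hc, neg_smul, sub_eq_add_neg]
    rw [f1, f2, det_smul, det_smul, det_one_add_mul_comm]
    simp [pow_succ]; ring
  rw [← h2, auxU_det, e2, e1, ← h1, auxU_det]

lemma auxE_sq (k : ℕ) : auxE k * auxE k = auxE k := by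
  simp [auxE]

lemma auxE_t (k : ℕ) : (auxE k)ᴴ = auxE k := by
  simp [auxE]

lemma aux_posdef_s12 (k : ℕ) (a : ℝ) (ha : 0 ≤ a) :
    (fromBlocks (1 + a • ((auxD k)ᵀ * auxD k) + a • auxE k) (-(a • auxE k)) (-(a • auxE k))
      (1 + a • ((auxD k)ᵀ * auxD k) + a • auxE k)).PosDef := by
  have h1 := (posSemidef_conjTranspose_mul_self
    (fromBlocks (auxD k) 0 0 (auxD k))).smul ha
  have h2 := (posSemidef_conjTranspose_mul_self
    (fromBlocks (auxE k) (-auxE k) 0 (0 : Matrix (Fin (k+1)) (Fin (k+1)) ℝ))).smul ha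
  have h3 := ((PosDef.one (n := Fin (k+1) ⊕ Fin (k+1)) (R := ℝ)).add_posSemidef h1).add_posSemidef h2
  convert h3 using 1
  rw [← fromBlocks_one]
  simp only [fromBlocks_conjTranspose, fromBlocks_multiply, fromBlocks_smul, fromBlocks_add,
    auxE_sq, auxE_t, conjTranspose_neg, conjTranspose_zero]
  simp [auxE_sq]

def auxe (k : ℕ) : Fin (k + 1) ⊕ Fin (k + 1) ≃ Fin ((k + 1) + (k + 1)) :=
  (Equiv.sumCongr (Equiv.refl _) Fin.revPerm).trans finSumFinEquiv

lemma auxe_l (k : ℕ) (i : Fin (k + 1)) : (auxe k (Sum.inl i) : ℕ) = i := by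
  simp [auxe]

lemma auxe_r (k : ℕ) (i : Fin (k + 1)) : (auxe k (Sum.inr i) : ℕ) = k + 1 + (k - i) := by
  simp [auxe, Fin.val_rev]
  omega

lemma aux_sub (n : ℕ) (a b : Fin n) : ((a - b : Fin n) : ℕ) = if (b : ℕ) ≤ a then (a : ℕ) - b else n + a - b := by
  rw [Fin.sub_def]
  have := a.2
  have := b.2
  split_ifs with h
  · have : n - (b : ℕ) + a = n + (a - b) := by omega
    simp only [this, Nat.add_mod_left]
    exact Nat.mod_eq_of_lt (by omega)
  · have : n - (b : ℕ) + a = n + a - b := by omega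
    simp only [this]
    exact Nat.mod_eq_of_lt (by omega)

lemma aux_V (k : ℕ) (hk : 1 ≤ k) (α : ℝ) (v : Fin ((k + 1) + (k + 1)) → ℝ)
    (hv : ∀ l : Fin ((k + 1) + (k + 1)), v l =
      if (l : ℕ) = 0 then 1 + 2 * α
      else if (l : ℕ) = 1 ∨ (l : ℕ) = ((k + 1) + (k + 1)) - 1 then -α
      else 0) : (circulant v).submatrix (auxe k) (auxe k) =
      fromBlocks (1 + α • ((auxD k)ᵀ * auxD k) + α • auxE k) (-(α • auxE k)) (-(α • auxE k))
      (1 + α • ((auxD k)ᵀ * auxD k) + α • auxE k) := by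
  ext i j
  rcases i with i | i <;> rcases j with j | j <;>
  simp only [submatrix_apply, circulant_apply, hv, aux_sub, auxe_l, auxe_r, fromBlocks_apply₁₁,
    fromBlocks_apply₁₂, fromBlocks_apply₂₁, fromBlocks_apply₂₂, Matrix.add_apply, Matrix.smul_apply, Matrix.neg_apply,
    auxDtD, Matrix.one_apply, auxE, diagonal_apply, Fin.ext_iff, smul_eq_mul]
  all_goals
    have hi := i.2
    have hj := j.2
    by_cases hij : (i : ℕ) = j
    · simp only [hij, if_true, if_false]
      split_ifs <;> first | omega | ring
    · simp only [hij, if_true, if_false]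
      split_ifs <;> first | omega | ring

/-- **Corollary 1.** For `n ≥ 4` even, `α ≥ 0`, and `V` the
nearest-neighbor circulant potential matrix (`v₀ = 1 + 2α`,
`v₁ = v_{n-1} = -α`, rest `0`), `V` is positive definite and the logarithmic
negativity of the symmetrically bisected chain is
`N = (1/2) log₂(1 + 4α)` — in particular, independent of the chain length `n`. -/
theorem logneg_nearest_neighbor_bisected_chain
    (n : ℕ) (hn4 : 4 ≤ n) (hn : Even n)
    (α : ℝ) (hα : 0 ≤ α)
    (v : Fin n → ℝ)
    (hv : ∀ l : Fin n, v l =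
      if (l : ℕ) = 0 then 1 + 2 * α
      else if (l : ℕ) = 1 ∨ (l : ℕ) = n - 1 then -α
      else 0)
    (V : Matrix (Fin n) (Fin n) ℝ) (hV : V = Matrix.circulant v)
    (P : Matrix (Fin n) (Fin n) ℝ)
    (hP : P = Matrix.diagonal (fun i : Fin n => if (i : ℕ) < n / 2 then (1 : ℝ) else -1))
    (Q : Matrix (Fin n) (Fin n) ℝ)
    (hQ : Q = mpow V (-(1/2)) * P * mpow V (1/2) * P)
    (lam : Fin n → ℝ)
    (hlam : Q.charpoly = ∏ j : Fin n, (X - C (lam j)))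
    (N : ℝ) (hN : N = -∑ j : Fin n, Real.logb 2 (min 1 (lam j))) :
    V.PosDef ∧ N = (1 / 2) * Real.logb 2 (1 + 4 * α) := by
  obtain ⟨k, rfl⟩ : ∃ k, n = (k + 1) + (k + 1) := by
    obtain ⟨r, hr⟩ := hn
    exact ⟨r - 1, by omega⟩
  have hk : 1 ≤ k := by omega
  have hblk := aux_V k hk α v hv
  rw [← hV] at hblk
  have hpd' := aux_posdef_s12 k α hα
  have hpd : V.PosDef := by
    rw [← hblk] at hpd'
    have := hpd'.submatrix (auxe k).symm.injective
    simpa using this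
  refine ⟨hpd, ?_⟩
  have hPb : P.submatrix (auxe k) (auxe k) = fromBlocks 1 0 0 (-1) := by
    rw [hP, submatrix_diagonal_equiv]
    ext i j
    rcases i with i | i <;> rcases j with j | j <;>
    simp only [diagonal_apply, fromBlocks_apply₁₁,
      fromBlocks_apply₁₂, fromBlocks_apply₂₁, fromBlocks_apply₂₂, Function.comp, auxe_l, auxe_r,
      Matrix.one_apply, Matrix.neg_apply, Sum.inl.injEq, Sum.inr.injEq, reduceCtorEq, if_false, Matrix.zero_apply]
    all_goals
      have hi := i.2
      split_ifs <;> first | omega | norm_num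
  set M := (mpow V (1/2)).submatrix (auxe k) (auxe k) with hM
  set Mi := (mpow V (-(1/2))).submatrix (auxe k) (auxe k) with hMi
  have hMpd : M.PosDef := (aux_mpow_posDef hpd).submatrix (auxe k).injective
  have hMM : M * M = V.submatrix (auxe k) (auxe k) := by
    rw [hM, submatrix_mul_equiv, aux_mpow_mul hpd]
    norm_num [aux_mpow_one hpd]
  have hMiM : Mi * M = 1 := by
    rw [hM, hMi, submatrix_mul_equiv, aux_mpow_mul hpd, neg_add_cancel, aux_mpow_zero hpd,
      submatrix_one_equiv]
  have hcomm : Commute M (fromBlocks 0 1 1 0) := by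
    set J : Matrix (Fin (k+1) ⊕ Fin (k+1)) (Fin (k+1) ⊕ Fin (k+1)) ℝ := fromBlocks 0 1 1 0 with hJ
    have hJ' : J = (J.submatrix (auxe k).symm (auxe k).symm).submatrix (auxe k) (auxe k) := by simp
    have h0 : Commute (V.submatrix (auxe k) (auxe k)) J := by
      rw [hblk, Commute, SemiconjBy, hJ, fromBlocks_multiply, fromBlocks_multiply]
      simp
    have h1 : Commute V (J.submatrix (auxe k).symm (auxe k).symm) := by
      have := congrArg (fun Z => Z.submatrix (auxe k).symm (auxe k).symm) h0.eq
      simp only [← submatrix_mul_equiv _ _ _ (auxe k).symm _] at this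
      simpa [Commute, SemiconjBy] using this
    have h2 : Commute (mpow V (1/2)) (J.submatrix (auxe k).symm (auxe k).symm) := h1.cfc_real _
    have := congrArg (fun Z => Z.submatrix (auxe k) (auxe k)) h2.eq
    simp only [← submatrix_mul_equiv _ _ _ (auxe k) _, ← hJ'] at this
    exact this
  have hB : (-(-(α • auxE k))).PosSemidef := by
    rw [neg_neg]
    have := (posSemidef_conjTranspose_mul_self (auxE k)).smul hα
    rwa [auxE_t, auxE_sq] at this
  have hchar : (Mi * fromBlocks 1 0 0 (-1) * M * fromBlocks 1 0 0 (-1)).charpoly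
      = ∏ j, (X - C (lam j)) := by
    rw [← hlam, ← hPb, hM, hMi, submatrix_mul_equiv, submatrix_mul_equiv, submatrix_mul_equiv, ← hQ]
    exact charpoly_reindex (auxe k).symm Q
  rw [hblk] at hMM
  rw [hN, aux_main hMpd hMM hMiM hcomm hB lam hchar]
  have g1 : 1 + α • ((auxD k)ᵀ * auxD k) + α • auxE k + -(α • auxE k)
      = 1 + α • ((auxD k)ᵀ * auxD k) := by abel
  have g2 : 1 + α • ((auxD k)ᵀ * auxD k) + α • auxE k - -(α • auxE k)
      = 1 + α • ((auxD k)ᵀ * auxD k) + (2 * α) • auxE k := by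
    rw [two_mul, add_smul]; abel
  have hdpos : 0 < (1 + α • ((auxD k)ᵀ * auxD k)).det := by
    have := ((PosDef.one (n := Fin (k+1)) (R := ℝ)).add_posSemidef
      ((posSemidef_conjTranspose_mul_self (auxD k)).smul hα)).det_pos
    simpa using this
  rw [g1, g2, aux_det_s12 k hk α hα]
  have : (1 + α • ((auxD k)ᵀ * auxD k)).det / ((1 + 4 * α) * (1 + α • ((auxD k)ᵀ * auxD k)).det)
      = (1 + 4 * α)⁻¹ := by
    have hc : (1 + 4 * α) ≠ 0 := by positivity
    field_simp
  rw [this, Real.logb_inv]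
  ring
end
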